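/- There is a universal constant c > 0 with the following property. Let γ be an R-regular arclength-parametrized C^1 simple curve tangentially attached to ℝ₊ with ω(R) ≤ 1/5, let η = √γ with capacity parametrization t(s) and driving function W. If |π/2 − arg(η'(t))| ≤ θ for some 0 ≤ θ < π/4 and all t ∈ [0,T], then |W_{t(s)}| ≤ c·θ·√s for all s ∈ [0,R]. -/

import Mathlib

open Set Filter Complex

/-- The open upper half-plane, as a subset of `ℂ`. -/
def UHP : Set ℂ := {z : ℂ | 0 < z.im}

/-- `g` is the (hydrodynamically normalized) mapping-out function of the
compact `ℍ`-hull `K`. -/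
def IsMappingOut (K : Set ℂ) (g : ℂ → ℂ) : Prop :=
  DifferentiableOn ℂ g (UHP \ K) ∧ Set.BijOn g (UHP \ K) UHP ∧
    Tendsto (fun z => g z - z)
      (comap (fun z : ℂ => ‖z‖) atTop ⊓ 𝓟 (UHP \ K)) (nhds 0)

/-- The hull `K` has half-plane capacity `a`. -/
def HasHCap (K : Set ℂ) (a : ℝ) : Prop :=
  ∃ g, IsMappingOut K g ∧
    Tendsto (fun z => z * (g z - z))
      (comap (fun z : ℂ => ‖z‖) atTop ⊓ 𝓟 (UHP \ K)) (nhds (a : ℂ))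

/-- The branch of the square root mapping `ℂ ∖ ℝ₊` into the upper half-plane. -/
noncomputable def sqrtH (z : ℂ) : ℂ := Complex.I * ((-z) ^ ((1:ℂ)/2))

open scoped Topology
open Bornology

lemma isOpen_UHP : IsOpen UHP := isOpen_lt continuous_const continuous_im

lemma isPreconnected_UHP : IsPreconnected UHP := (convex_halfSpace_im_gt 0).isPreconnected

lemma neBot_nhdsWithin_UHP {x : ℂ} (hx : 0 ≤ x.im) : (𝓝[UHP] x).NeBot := by
  rw [← mem_closure_iff_nhdsWithin_neBot, UHP, closure_setOfPred_lt_im]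
  exact hx

/-- A left inverse of an injective holomorphic function is continuous on its image. -/
lemma continuousAt_leftInverse {Ω : Set ℂ} (ho : IsOpen Ω) {g h : ℂ → ℂ}
    (hg : DifferentiableOn ℂ g Ω) (hh : ∀ z ∈ Ω, h (g z) = z) {z : ℂ} (hz : z ∈ Ω) :
    ContinuousAt h (g z) := by
  have an : AnalyticAt ℂ g z := hg.analyticAt (ho.mem_nhds hz)
  rcases an.eventually_constant_or_nhds_le_map_nhds with hc | hle
  · exfalso
    have h1 : ∀ᶠ w in 𝓝[≠] z, w ∈ Ω ∧ g w = g z :=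
      nhdsWithin_le_nhds ((ho.eventually_mem hz).and hc)
    obtain ⟨w, ⟨hwΩ, hwg⟩, hw⟩ := (h1.and self_mem_nhdsWithin).exists
    apply hw
    change w = z
    rw [← hh w hwΩ, hwg, hh z hz]
  · rw [ContinuousAt, hh z hz]
    intro V hV
    have : g '' (V ∩ Ω) ∈ 𝓝 (g z) := hle (image_mem_map (inter_mem hV (ho.mem_nhds hz)))
    refine mem_map.2 (mem_of_superset this ?_)
    rintro _ ⟨z', ⟨hzV, hzΩ⟩, rfl⟩
    simpa [hh z' hzΩ] using hzV

/-- Maximum principle on a simply connected domain, in the coordinates of a uniformization of the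
domain by the upper half-plane. -/
lemma re_le_zero_of_boundary {Ω : Set ℂ} (ho : IsOpen Ω) {g h F : ℂ → ℂ}
    (hgΩ : MapsTo g Ω UHP) (hhU : MapsTo h UHP Ω) (hhg : ∀ z ∈ Ω, h (g z) = z)
    (hhc : ContinuousOn h UHP) (hF : DifferentiableOn ℂ F Ω)
    (hreal : ∀ x : ℝ, ∀ δ > 0, ∀ᶠ w in 𝓝[UHP] (x : ℂ), (F (h w)).re ≤ δ)
    (hinf : ∀ δ > 0, ∀ᶠ w in cobounded ℂ ⊓ 𝓟 UHP, (F (h w)).re ≤ δ) :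
    ∀ z ∈ Ω, (F z).re ≤ 0 := by
  intro z1 hz1
  by_contra! hpos
  set c := (F z1).re with hc
  have hφ : ContinuousOn (fun w => (F (h w)).re) UHP :=
    continuous_re.comp_continuousOn (hF.continuousOn.comp hhc hhU)
  set A : Set ℂ := {w | w ∈ UHP ∧ c ≤ (F (h w)).re} with hA
  have hAc : IsClosed A := by
    refine isClosed_of_closure_subset fun w hw => ?_
    have hwim : w ∈ closure UHP := closure_mono (fun _ h => h.1) hw
    rw [UHP, closure_setOfPred_lt_im] at hwim
    have hfr : ∃ᶠ y in 𝓝[UHP] w, c ≤ (F (h y)).re := by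
      rw [frequently_nhdsWithin_iff]
      exact (mem_closure_iff_frequently.1 hw).mono fun y hy => ⟨hy.2, hy.1⟩
    rcases (show 0 ≤ w.im from hwim).eq_or_lt with h0 | h0
    · have hwr : ((w.re : ℝ) : ℂ) = w := Complex.ext (by simp) (by simp [h0])
      have := hreal w.re (c / 2) (by linarith)
      rw [hwr] at this
      obtain ⟨y, hy1, hy2⟩ := (hfr.and_eventually this).exists
      linarith
    · refine ⟨h0, ?_⟩
      by_contra! hlt
      obtain ⟨y, hy1, hy2⟩ := (hfr.and_eventually ((hφ w h0).eventually_lt_const hlt)).exists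
      linarith
  have hAb : IsBounded A := by
    have := eventually_inf_principal.1 (hinf (c / 2) (by linarith))
    refine (isBounded_def.2 (mem_of_superset this fun w hw hwA => ?_))
    have := hw hwA.1
    linarith [hwA.2]
  obtain ⟨w0, hw0, hmax⟩ := (Metric.isCompact_of_isClosed_isBounded hAc hAb).exists_isMaxOn
    ⟨g z1, hgΩ hz1, by rw [hhg z1 hz1]⟩ (hφ.mono fun w hw => hw.1)
  have hconn : IsPreconnected Ω := by
    have : h '' UHP = Ω :=
      Subset.antisymm hhU.image_subset fun z hz => ⟨g z, hgΩ hz, hhg z hz⟩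
    rw [← this]
    exact isPreconnected_UHP.image h hhc
  have hmax' : IsMaxOn (norm ∘ fun z => exp (F z)) Ω (h w0) := by
    intro z hz
    simp only [mem_ofPred_eq, Function.comp, norm_exp]
    refine Real.exp_le_exp.2 ?_
    by_cases hzA : g z ∈ A
    · have := hmax hzA
      simpa [hhg z hz] using this
    · have : ¬ c ≤ (F (h (g z))).re := fun h' => hzA ⟨hgΩ hz, h'⟩
      rw [hhg z hz] at this
      linarith [hw0.2]
  have heq := Complex.norm_eqOn_of_isPreconnected_of_isMaxOn hconn ho hF.cexp (hhU hw0.1) hmax'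
  have : (𝓝[UHP] ((0 : ℝ) : ℂ)).NeBot := neBot_nhdsWithin_UHP (by simp)
  obtain ⟨w, hw1, hw2⟩ :=
    ((hreal 0 (c / 2) (by linarith)).and self_mem_nhdsWithin).exists
  have := heq (hhU hw2)
  simp only [Function.comp, Function.const, norm_exp, Real.exp_eq_exp] at this
  linarith [hw0.2]

/-- Points where a uniformizing map tends to a real point other than the image of `p` have
boundary cluster values different from `p`, so boundary information can be transported. -/
lemma eventually_inverse_of_boundary {Ω : Set ℂ} (hΩ : Ω ⊆ UHP) {g h : ℂ → ℂ}
    (hg : DifferentiableOn ℂ g Ω) (hgΩ : MapsTo g Ω UHP) (hhU : MapsTo h UHP Ω)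
    (hgh : ∀ w ∈ UHP, g (h w) = w)
    (hinf : Tendsto (fun z => g z - z) (cobounded ℂ ⊓ 𝓟 Ω) (𝓝 0)) {W : ℝ} {p : ℂ}
    (hp : Tendsto g (𝓝[Ω] p) (𝓝 (W : ℂ))) {P : ℂ → Prop}
    (hloc : ∀ z₀ ∉ Ω, 0 ≤ z₀.im → z₀ ≠ p → ∀ᶠ z in 𝓝[Ω] z₀, P z) {x : ℝ} (hx : x ≠ W) :
    ∀ᶠ w in 𝓝[UHP] (x : ℂ), P (h w) := by
  by_contra hne
  have hne' : ∃ᶠ w in 𝓝[UHP] (x : ℂ), ¬ P (h w) := not_eventually.1 hne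
  have : (𝓝[UHP] (x : ℂ) ⊓ 𝓟 {w | ¬ P (h w)}).NeBot :=
    frequently_mem_iff_neBot.1 hne'
  obtain ⟨U, hU⟩ := Ultrafilter.exists_le (𝓝[UHP] (x : ℂ) ⊓ 𝓟 {w | ¬ P (h w)})
  have hU1 : (U : Filter ℂ) ≤ 𝓝[UHP] (x : ℂ) := hU.trans inf_le_left
  have hUn : (U : Filter ℂ) ≤ 𝓝 (x : ℂ) := hU1.trans nhdsWithin_le_nhds
  have hUP : ∀ᶠ w in (U : Filter ℂ), ¬ P (h w) := hU.trans inf_le_right (mem_principal_self _)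
  have hUH : ∀ᶠ w in (U : Filter ℂ), w ∈ UHP := hU1 self_mem_nhdsWithin
  have hUΩ : Tendsto h U (𝓟 Ω) := tendsto_principal.2 (hUH.mono fun w hw => hhU hw)
  by_cases hb : ∃ r : ℝ, ∀ᶠ w in (U : Filter ℂ), h w ∈ Metric.closedBall 0 r
  · obtain ⟨r, hr⟩ := hb
    obtain ⟨z₀, -, hz₀⟩ := (isCompact_closedBall (0 : ℂ) r).ultrafilter_le_nhds' (U.map h) hr
    have ht : Tendsto h U (𝓝 z₀) := hz₀
    have htΩ : Tendsto h U (𝓝[Ω] z₀) := tendsto_inf.2 ⟨ht, hUΩ⟩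
    have hUid : ∀ᶠ w in (U : Filter ℂ), g (h w) = w := hUH.mono hgh
    have hunique : ∀ {a : ℂ}, Tendsto g (𝓝[Ω] z₀) (𝓝 a) → a = x := by
      intro a ha
      exact tendsto_nhds_unique ((ha.comp htΩ).congr' hUid) hUn
    have him : 0 ≤ z₀.im :=
      ge_of_tendsto ((continuous_im.tendsto z₀).comp ht)
        (hUH.mono fun w hw => (hΩ (hhU hw)).le)
    have hz₀Ω : z₀ ∉ Ω := by
      intro hmem
      have := hunique (hg.continuousOn z₀ hmem)
      have h2 : 0 < (g z₀).im := hgΩ hmem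
      rw [this] at h2
      simp at h2
    have hz₀p : z₀ ≠ p := by
      rintro rfl
      exact hx (ofReal_injective (hunique hp)).symm
    obtain ⟨w, hw1, hw2⟩ := (hUP.and (htΩ (hloc z₀ hz₀Ω him hz₀p))).exists
    exact hw1 hw2
  · push Not at hb
    have ht : Tendsto h U (cobounded ℂ) := by
      rw [← comap_norm_atTop, tendsto_comap_iff, tendsto_atTop]
      intro r
      filter_upwards [hb r] with w hw
      simp only [Metric.mem_closedBall, dist_zero_right, not_le] at hw
      exact hw.le
    have h0 : Tendsto (fun w => w - h w) U (𝓝 0) := by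
      refine (hinf.comp (tendsto_inf.2 ⟨ht, hUΩ⟩)).congr' ?_
      filter_upwards [hUH] with w hw
      simp [hgh w hw]
    have h1 : Tendsto h U (𝓝 ((x : ℂ) - 0)) := by
      simpa using (show Tendsto (fun w : ℂ => w) U (𝓝 (x : ℂ)) from hUn).sub h0
    exact (not_tendsto_nhds_of_tendsto_atTop (tendsto_norm_cobounded_atTop.comp ht) _) h1.norm

/-- A real point far from the origin has a nearby real cluster value under a map that is close to
the identity at infinity. -/
lemma exists_real_cluster {Ω : Set ℂ} (hΩ : Ω ⊆ UHP) {g h : ℂ → ℂ}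
    (hgΩ : MapsTo g Ω UHP) (hhU : MapsTo h UHP Ω) (hhg : ∀ z ∈ Ω, h (g z) = z)
    (hhc : ∀ w ∈ UHP, ContinuousAt h w) {r : ℝ}
    (hr : ∀ z ∈ Ω, r < ‖z‖ → ‖g z - z‖ < 1) {x : ℝ} (hx : r < |x|) [hne : (𝓝[Ω] (x : ℂ)).NeBot]
    {P : ℂ → Prop} (hP : ∀ᶠ z in 𝓝[Ω] (x : ℂ), P z) :
    ∃ x' : ℝ, |x' - x| ≤ 2 ∧ ∃ᶠ w in 𝓝[UHP] (x' : ℂ), P (h w) := by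
  obtain ⟨U, hU⟩ := Ultrafilter.exists_le (𝓝[Ω] (x : ℂ))
  have hUn : Tendsto id (U : Filter ℂ) (𝓝 (x : ℂ)) := hU.trans nhdsWithin_le_nhds
  have hUΩ : ∀ᶠ z in (U : Filter ℂ), z ∈ Ω := hU self_mem_nhdsWithin
  have h1 : ∀ᶠ z in (U : Filter ℂ), g z ∈ Metric.closedBall (x : ℂ) 2 := by
    have hb := hUn (Metric.ball_mem_nhds (x : ℂ) one_pos)
    have hn : ∀ᶠ z in (U : Filter ℂ), r < ‖z‖ :=
      hUn.norm.eventually_const_lt (by simpa using hx)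
    filter_upwards [hUΩ, hb, hn] with z hz hzb hzn
    have e1 := hr z hz hzn
    have e2 : ‖z - x‖ < 1 := by simpa [dist_eq_norm] using hzb
    rw [Metric.mem_closedBall, dist_eq_norm]
    calc ‖g z - x‖ = ‖(g z - z) + (z - x)‖ := by ring_nf
      _ ≤ _ := norm_add_le _ _
      _ ≤ 2 := by linarith
  obtain ⟨w₀, hw₀, hlim⟩ := (isCompact_closedBall (x : ℂ) 2).ultrafilter_le_nhds' (U.map g) h1
  have ht : Tendsto g U (𝓝 w₀) := hlim
  have him : 0 ≤ w₀.im :=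
    ge_of_tendsto ((continuous_im.tendsto w₀).comp ht) (hUΩ.mono fun z hz => (hgΩ hz).le)
  have him0 : w₀.im = 0 := by
    by_contra hne
    have hpos : w₀ ∈ UHP := lt_of_le_of_ne him (Ne.symm hne)
    have h2 : Tendsto id (U : Filter ℂ) (𝓝 (h w₀)) :=
      ((hhc w₀ hpos).tendsto.comp ht).congr' (hUΩ.mono fun z hz => hhg z hz)
    have h3 := tendsto_nhds_unique h2 hUn
    have h4 : 0 < (h w₀).im := hΩ (hhU hpos)
    rw [h3] at h4
    simp at h4
  have hwr : ((w₀.re : ℝ) : ℂ) = w₀ := Complex.ext (by simp) (by simp [him0])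
  refine ⟨w₀.re, ?_, ?_⟩
  · rw [Metric.mem_closedBall, dist_eq_norm] at hw₀
    have := (abs_re_le_norm (w₀ - x)).trans hw₀
    simpa using this
  · rw [hwr]
    have htU : Tendsto g U (𝓝[UHP] w₀) :=
      tendsto_inf.2 ⟨ht, tendsto_principal.2 (hUΩ.mono fun z hz => hgΩ hz)⟩
    refine htU.frequently (Eventually.frequently ?_)
    filter_upwards [hU hP, hUΩ] with z hz hzΩ
    rwa [hhg z hzΩ]

/-- If a continuous real function on the upper half-plane takes values near `a` or near `b` at each
point of a real interval, then it takes values near only one of them. -/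
lemma forall_eventually_of_frequently {ψ : ℂ → ℝ} (hψ : ContinuousOn ψ UHP) {a b ρ : ℝ}
    (hab : 2 * ρ ≤ |a - b|) {I : Set ℝ} (hI : IsPreconnected I)
    (h : ∀ x ∈ I, ∀ᶠ w in 𝓝[UHP] (x : ℂ), |ψ w - a| < ρ ∨ |ψ w - b| < ρ) {x₀ : ℝ}
    (hx₀ : x₀ ∈ I) (hfr : ∃ᶠ w in 𝓝[UHP] (x₀ : ℂ), |ψ w - a| < ρ) :
    ∀ x ∈ I, ∀ᶠ w in 𝓝[UHP] (x : ℂ), |ψ w - a| < ρ := by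
  have hdisj : ∀ y : ℝ, |y - a| < ρ → |y - b| < ρ → False := by
    intro y h1 h2
    have := abs_sub_le a y b
    rw [abs_sub_comm a y] at this
    linarith
  have htype : ∀ x ∈ I, (∀ᶠ w in 𝓝[UHP] (x : ℂ), |ψ w - a| < ρ) ∨
      (∀ᶠ w in 𝓝[UHP] (x : ℂ), |ψ w - b| < ρ) := by
    intro x hx
    obtain ⟨r, hr, hball⟩ := Metric.mem_nhdsWithin_iff.1 (h x hx)
    have hpre : IsPreconnected (ψ '' (Metric.ball (x : ℂ) r ∩ UHP)) :=
      (((convex_ball _ _).inter (convex_halfSpace_im_gt 0)).isPreconnected).image _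
        (hψ.mono inter_subset_right)
    have hmem : Metric.ball (x : ℂ) r ∩ UHP ∈ 𝓝[UHP] (x : ℂ) :=
      inter_mem (nhdsWithin_le_nhds (Metric.ball_mem_nhds _ hr)) self_mem_nhdsWithin
    rcases hpre.subset_or_subset (Metric.isOpen_ball (x := a) (ε := ρ))
      (Metric.isOpen_ball (x := b) (ε := ρ))
      (Set.disjoint_left.2 fun y h1 h2 => hdisj y h1 h2)
      (by rintro _ ⟨w, hw, rfl⟩; exact hball hw) with hs | hs
    · left
      filter_upwards [hmem] with w hw using hs (mem_image_of_mem _ hw)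
    · right
      filter_upwards [hmem] with w hw using hs (mem_image_of_mem _ hw)
  have hopen : ∀ c : ℝ, IsOpen {x : ℝ | ∀ᶠ w in 𝓝[UHP] (x : ℂ), |ψ w - c| < ρ} := by
    intro c
    rw [isOpen_iff_mem_nhds]
    intro x hx
    exact (continuous_ofReal.tendsto x) (eventually_nhds_nhdsWithin.2 hx)
  rcases hI.subset_or_subset (hopen a) (hopen b)
    (Set.disjoint_left.2 fun y h1 h2 => by
      rw [mem_ofPred_eq] at h1 h2
      have : (𝓝[UHP] (y : ℂ)).NeBot := neBot_nhdsWithin_UHP (by simp)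
      obtain ⟨w, h3, h4⟩ := (h1.and h2).exists
      exact hdisj _ h3 h4) htype with hs | hs
  · exact hs
  · obtain ⟨w, h1, h2⟩ := (hfr.and_eventually (hs hx₀)).exists
    exact (hdisj _ h1 h2).elim

/-- Comparison of the argument of a uniformizing map `g` of `Ω`, centered at the image `W` of the
boundary point `p`, with the imaginary part of a holomorphic function `H` whose boundary values are
near `0` or near `π`, with an error controlled by the positive harmonic function `re Q`. -/
lemma abs_arg_sub_im_le {Ω : Set ℂ} (ho : IsOpen Ω) (hΩ : Ω ⊆ UHP) {g : ℂ → ℂ}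
    (hg : DifferentiableOn ℂ g Ω) (hb : BijOn g Ω UHP)
    (hinf : Tendsto (fun z => g z - z) (cobounded ℂ ⊓ 𝓟 Ω) (𝓝 0)) {W : ℝ} {p : ℂ}
    (hp : Tendsto g (𝓝[Ω] p) (𝓝 (W : ℂ))) {H Q : ℂ → ℂ} (hH : DifferentiableOn ℂ H Ω)
    (hQ : DifferentiableOn ℂ Q Ω) (hQ0 : ∀ z ∈ Ω, 0 ≤ (Q z).re) {C : ℝ}
    (hC : ∀ z ∈ Ω, |(H z).im| ≤ C)
    (hloc : ∀ z₀ ∉ Ω, 0 ≤ z₀.im → z₀ ≠ p → ∀ δ > 0, ∀ᶠ z in 𝓝[Ω] z₀,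
      (|(H z).im - 0| < Real.pi / 2 ∧ |(H z).im| ≤ (Q z).re + δ) ∨
      (|(H z).im - Real.pi| < Real.pi / 2 ∧ |(H z).im - Real.pi| ≤ (Q z).re + δ))
    (hR : ∃ᶠ x : ℝ in atTop, (𝓝[Ω] (x : ℂ)).NeBot ∧
      ∀ᶠ z in 𝓝[Ω] (x : ℂ), |(H z).im - 0| < Real.pi / 2)
    (hL : ∃ᶠ x : ℝ in atBot, (𝓝[Ω] (x : ℂ)).NeBot ∧
      ∀ᶠ z in 𝓝[Ω] (x : ℂ), |(H z).im - Real.pi| < Real.pi / 2) {z : ℂ} (hz : z ∈ Ω) :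
    |arg (g z - W) - (H z).im| ≤ (Q z).re := by
  set h := Function.invFunOn g Ω with hh
  have hgΩ : MapsTo g Ω UHP := hb.mapsTo
  have hhg : ∀ z ∈ Ω, h (g z) = z := fun z hz => hb.injOn.leftInvOn_invFunOn hz
  have hgh : ∀ w ∈ UHP, g (h w) = w := hb.surjOn.rightInvOn_invFunOn
  have hhU : MapsTo h UHP Ω := hb.surjOn.mapsTo_invFunOn
  have hhc : ∀ w ∈ UHP, ContinuousAt h w := by
    intro w hw
    have := continuousAt_leftInverse ho hg hhg (hhU hw)
    rwa [hgh w hw] at this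
  have hhc' : ContinuousOn h UHP := fun w hw => (hhc w hw).continuousWithinAt
  have hψ : ContinuousOn (fun w => (H (h w)).im) UHP :=
    continuous_im.comp_continuousOn (hH.continuousOn.comp hhc' hhU)
  have hloc' := fun (x : ℝ) (hx : x ≠ W) (δ : ℝ) (hδ : 0 < δ) =>
    eventually_inverse_of_boundary hΩ hg hgΩ hhU hgh hinf hp
      (fun z₀ h1 h2 h3 => hloc z₀ h1 h2 h3 δ hδ) hx
  obtain ⟨r, hr⟩ : ∃ r, ∀ z ∈ Ω, r < ‖z‖ → ‖g z - z‖ < 1 := by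
    have h1 := hinf (Metric.ball_mem_nhds 0 one_pos)
    rw [mem_map, mem_inf_principal, hasBasis_cobounded_norm.mem_iff] at h1
    obtain ⟨r, -, hr⟩ := h1
    exact ⟨r, fun z hz hrz => by simpa using hr (show r ≤ ‖z‖ from hrz.le) hz⟩
  have hpi := Real.pi_pos
  have hright : ∀ x ∈ Ioi W, ∀ᶠ w in 𝓝[UHP] (x : ℂ), |(H (h w)).im - 0| < Real.pi / 2 := by
    obtain ⟨x, ⟨hne, hx⟩, hx2⟩ := (hR.and_eventually (eventually_gt_atTop (max |r| (W + 2)))).exists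
    have h1 := (le_max_left _ _).trans_lt hx2
    have h2 := (le_max_right _ _).trans_lt hx2
    obtain ⟨x', hx', hfr⟩ := exists_real_cluster hΩ hgΩ hhU hhg hhc hr
      ((le_abs_self r).trans_lt (h1.trans_le (le_abs_self x))) hx
    refine forall_eventually_of_frequently hψ (b := Real.pi) ?_ isPreconnected_Ioi ?_
      (x₀ := x') ?_ hfr
    · rw [zero_sub, abs_neg, abs_of_pos hpi]; linarith
    · intro y hy
      exact (hloc' y (ne_of_gt hy) 1 one_pos).mono fun w hw => hw.imp And.left And.left
    · have := (abs_le.1 hx').1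
      simp only [mem_Ioi]; linarith
  have hleft : ∀ x ∈ Iio W, ∀ᶠ w in 𝓝[UHP] (x : ℂ),
      |(H (h w)).im - Real.pi| < Real.pi / 2 := by
    obtain ⟨x, ⟨hne, hx⟩, hx2⟩ :=
      (hL.and_eventually (eventually_lt_atBot (min (-|r|) (W - 2)))).exists
    have h1 := hx2.trans_le (min_le_left _ _)
    have h2 := hx2.trans_le (min_le_right _ _)
    obtain ⟨x', hx', hfr⟩ := exists_real_cluster hΩ hgΩ hhU hhg hhc hr
      (x := x) (by linarith [neg_le_abs x, le_abs_self r]) hx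
    refine forall_eventually_of_frequently hψ (b := 0) ?_ isPreconnected_Iio ?_
      (x₀ := x') ?_ hfr
    · rw [sub_zero, abs_of_pos hpi]; linarith
    · intro y hy
      exact (hloc' y (ne_of_lt hy) 1 one_pos).mono fun w hw =>
        (hw.imp And.left And.left).symm
    · have := (abs_le.1 hx').2
      simp only [mem_Iio]; linarith
  -- the difference of the two arguments is small near each real point other than `W`
  have hdiff : ∀ x : ℝ, x ≠ W → ∀ δ > 0, ∀ᶠ w in 𝓝[UHP] (x : ℂ),
      |arg (w - W) - (H (h w)).im| ≤ (Q (h w)).re + δ := by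
    intro x hx δ hδ
    rcases lt_or_gt_of_ne hx with hlt | hgt
    · have harg : Tendsto (fun w : ℂ => arg (w - W)) (𝓝[UHP] (x : ℂ)) (𝓝 Real.pi) := by
        have h1 := continuousWithinAt_arg_of_re_neg_of_im_zero (z := (x : ℂ) - W)
          (by simpa using hlt) (by simp)
        have h2 : Tendsto (fun w : ℂ => w - W) (𝓝[UHP] (x : ℂ)) (𝓝[{z : ℂ | 0 ≤ z.im}] (x - W)) := by
          refine tendsto_inf.2 ⟨?_, tendsto_principal.2 ?_⟩
          · exact ((continuous_id.sub continuous_const).tendsto' _ _ rfl).mono_left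
              nhdsWithin_le_nhds
          · filter_upwards [self_mem_nhdsWithin] with w hw
            have : 0 < w.im := hw
            simpa using this.le
        have h3 := h1.tendsto.comp h2
        have h4 : arg ((x : ℂ) - W) = Real.pi := by
          rw [← ofReal_sub]; exact arg_ofReal_of_neg (by linarith)
        rwa [h4] at h3
      filter_upwards [hleft x hlt, hloc' x hx (δ / 2) (by linarith),
        harg (Metric.ball_mem_nhds _ (show 0 < δ / 2 by linarith))] with w h1 h2 h3
      rcases h2 with h2 | h2
      · have h4 := abs_lt.1 h1; have h5 := abs_lt.1 h2.1
        linarith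
      · have h3' : |arg (w - W) - Real.pi| < δ / 2 := h3
        have := abs_sub_le (arg (w - W)) Real.pi (H (h w)).im
        rw [abs_sub_comm Real.pi] at this
        linarith [h2.2]
    · have harg : Tendsto (fun w : ℂ => arg (w - W)) (𝓝[UHP] (x : ℂ)) (𝓝 0) := by
        have h1 : ContinuousAt (fun w : ℂ => arg (w - W)) (x : ℂ) :=
          (continuousAt_arg (Or.inl (by simpa using hgt))).comp
            (continuousAt_id.sub continuousAt_const)
        have h4 : arg ((x : ℂ) - W) = 0 := by
          rw [← ofReal_sub]; exact arg_ofReal_of_nonneg (by linarith)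
        have h2 := h1.tendsto
        rw [h4] at h2
        exact h2.mono_left nhdsWithin_le_nhds
      filter_upwards [hright x hgt, hloc' x hx (δ / 2) (by linarith),
        harg (Metric.ball_mem_nhds _ (show 0 < δ / 2 by linarith))] with w h1 h2 h3
      rcases h2 with h2 | h2
      · have h3' : |arg (w - W) - 0| < δ / 2 := h3
        have := abs_sub_le (arg (w - W)) 0 (H (h w)).im
        rw [abs_sub_comm 0, sub_zero (H (h w)).im] at this
        linarith [h2.2]
      · have h4 := abs_lt.1 h1; have h5 := abs_lt.1 h2.1
        linarith
  set b : ℂ → ℝ := fun w => 2 * Real.log ‖w - W + I‖ - Real.log ‖w - W‖ with hbdef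
  have hb1 : ∀ w ∈ UHP, 0 ≤ Real.log ‖w - W + I‖ ∧ Real.log ‖w - W‖ ≤ Real.log ‖w - W + I‖ := by
    intro w hw
    have hw' : 0 < w.im := hw
    constructor
    · refine Real.log_nonneg ?_
      refine le_trans ?_ (abs_im_le_norm _)
      refine le_trans ?_ (le_abs_self _)
      simp only [add_im, sub_im, ofReal_im, I_im]; linarith
    · refine Real.log_le_log (norm_pos_iff.2 fun h0 => ?_) ?_
      · have := congrArg im h0
        simp at this; linarith
      · rw [norm_def, norm_def]
        refine Real.sqrt_le_sqrt ?_
        simp only [normSq_apply, add_re, sub_re, ofReal_re, I_re, add_im, sub_im, ofReal_im, I_im]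
        nlinarith
  have hmain : ∀ ε > 0, ∀ σ : ℝ, |σ| = 1 → ∀ z ∈ Ω,
      σ * (arg (g z - W) - (H z).im) ≤ (Q z).re + ε * b (g z) := by
    intro ε hε σ hσ z hz
    have hsub : ∀ z ∈ Ω, g z - W ∈ slitPlane ∧ g z - W + I ∈ slitPlane := by
      intro z hz
      have : 0 < (g z).im := hgΩ hz
      refine ⟨Or.inr ?_, Or.inr ?_⟩
      · simpa using this.ne'
      · simp only [add_im, sub_im, ofReal_im, I_im]; linarith
    set F : ℂ → ℂ := fun z => -I * σ * (log (g z - W) - H z) - Q z -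
      ε * (2 * log (g z - W + I) - log (g z - W)) with hF
    have hFre : ∀ z, (F z).re = σ * (arg (g z - W) - (H z).im) - (Q z).re - ε * b (g z) := by
      intro z
      simp [hF, hbdef, log_re, log_im]
    have hFd : DifferentiableOn ℂ F Ω := by
      have d1 : DifferentiableOn ℂ (fun z => g z - W) Ω := hg.sub_const _
      have d2 : DifferentiableOn ℂ (fun z => log (g z - W)) Ω := d1.clog fun z hz => (hsub z hz).1
      have d3 : DifferentiableOn ℂ (fun z => log (g z - W + I)) Ω :=
        (d1.add_const _).clog fun z hz => (hsub z hz).2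
      exact (((d2.sub hH).const_mul _).sub hQ).sub (((d3.const_mul _).sub d2).const_mul _)
    have hbound : ∀ w ∈ UHP, |arg (w - W) - (H (h w)).im| ≤ Real.pi + C := fun w hw =>
      (abs_sub _ _).trans (add_le_add (abs_arg_le_pi _) (hC _ (hhU hw)))
    have hσle : ∀ y : ℝ, σ * y ≤ |y| := fun y => by
      have := le_abs_self (σ * y)
      rwa [abs_mul, hσ, one_mul] at this
    have key := re_le_zero_of_boundary ho hgΩ hhU hhg hhc' hFd ?_ ?_ z hz
    · rw [hFre] at key
      linarith
    · intro x δ hδ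
      by_cases hx : x = W
      · subst hx
        have hlog : Tendsto (fun w : ℂ => -Real.log ‖w - x‖) (𝓝[UHP] (x : ℂ)) atTop := by
          refine tendsto_neg_atBot_atTop.comp (Real.tendsto_log_nhdsGT_zero.comp ?_)
          refine tendsto_inf.2 ⟨?_, tendsto_principal.2 ?_⟩
          · exact ((continuous_id.sub continuous_const).norm.tendsto' _ _ (by simp)).mono_left
              nhdsWithin_le_nhds
          · filter_upwards [self_mem_nhdsWithin] with w hw
            have hw' : 0 < w.im := hw
            refine norm_pos_iff.2 fun h0 => ?_
            have := congrArg im h0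
            simp at this; linarith
        filter_upwards [hlog.eventually_ge_atTop ((Real.pi + C) / ε), self_mem_nhdsWithin]
          with w hw hwU
        rw [hFre, hgh w hwU]
        have h1 := (hσle _).trans (hbound w hwU)
        have h2 := hQ0 _ (hhU hwU)
        have h3 := (div_le_iff₀' hε).1 (hw.trans (show _ ≤ b w by
          have := hb1 w hwU; simp only [hbdef]; linarith))
        linarith
      · filter_upwards [hdiff x hx δ hδ, self_mem_nhdsWithin] with w hw hwU
        rw [hFre, hgh w hwU]
        have h1 := (hσle _).trans hw
        have h3 : 0 ≤ ε * b w := mul_nonneg hε.le (by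
          have := hb1 w hwU; simp only [hbdef]; linarith)
        linarith
    · intro δ hδ
      have hlog : Tendsto (fun w : ℂ => Real.log ‖w - W + I‖) (cobounded ℂ) atTop := by
        refine Real.tendsto_log_atTop.comp ?_
        refine tendsto_atTop_mono (f := fun w : ℂ => ‖w‖ - ‖(W : ℂ) - I‖) (fun w => ?_) ?_
        · have := norm_sub_norm_le w ((W : ℂ) - I)
          rwa [show w - (W - I) = w - W + I by ring] at this
        · exact tendsto_atTop_add_const_right _ _ tendsto_norm_cobounded_atTop
      rw [eventually_inf_principal]
      filter_upwards [hlog.eventually_ge_atTop ((Real.pi + C) / ε)] with w hw hwU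
      rw [hFre, hgh w hwU]
      have h1 := (hσle _).trans (hbound w hwU)
      have h2 := hQ0 _ (hhU hwU)
      have h3 := (div_le_iff₀' hε).1 (hw.trans (show _ ≤ b w by
        have := hb1 w hwU; simp only [hbdef]; linarith))
      linarith
  have hlim : ∀ σ : ℝ, |σ| = 1 → σ * (arg (g z - W) - (H z).im) ≤ (Q z).re := by
    intro σ hσ
    have h1 : Tendsto (fun ε : ℝ => (Q z).re + ε * b (g z)) (𝓝[>] 0) (𝓝 (Q z).re) := by
      refine Tendsto.mono_left (Continuous.tendsto' (by fun_prop) _ _ (by simp)) nhdsWithin_le_nhds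
    refine ge_of_tendsto h1 ?_
    filter_upwards [self_mem_nhdsWithin] with ε hε using hmain ε hε σ hσ z hz
  have h1 := hlim 1 (by simp)
  have h2 := hlim (-1) (by simp)
  exact abs_le.2 ⟨by linarith, by linarith⟩

lemma arg_neg_I_mul {z : ℂ} (hz : 0 < z.im) : arg (-I * z) = arg z - Real.pi / 2 := by
  have hz0 : z ≠ 0 := by rintro rfl; simp at hz
  have h1 : 0 ≤ arg z := arg_nonneg_iff.2 hz.le
  have h2 := arg_le_pi z
  have hpi := Real.pi_pos
  rw [(arg_mul_eq_add_arg_iff (neg_ne_zero.2 I_ne_zero) hz0).2, arg_neg_I]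
  · ring
  · rw [arg_neg_I]; constructor <;> linarith

lemma arg_I_mul {z : ℂ} (hz : z.im < 0) : arg (I * z) = arg z + Real.pi / 2 := by
  have hz0 : z ≠ 0 := by rintro rfl; simp at hz
  have h1 : arg z < 0 := arg_neg_iff.2 hz
  have h2 := neg_pi_lt_arg z
  have hpi := Real.pi_pos
  rw [(arg_mul_eq_add_arg_iff I_ne_zero hz0).2, arg_I]
  · ring
  · rw [arg_I]; constructor <;> linarith

lemma log_neg_add_pi_mul_I {z : ℂ} (hz : 0 < z.im) : log (-z) + Real.pi * I = log z := by
  apply Complex.ext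
  · simp [log_re]
  · simp [log_im, arg_neg_eq_arg_sub_pi_of_im_pos hz]

lemma arg_eq_arctan_of_re_pos {z : ℂ} (hz : 0 < z.re) : arg z = Real.arctan (z.im / z.re) := by
  have h := abs_lt.1 (abs_arg_lt_pi_div_two_iff.2 (Or.inl hz))
  rw [← tan_arg, Real.arctan_tan h.1 h.2]

lemma abs_arctan_le (t : ℝ) : |Real.arctan t| ≤ |t| := by
  have key : ∀ s : ℝ, 0 ≤ s → Real.arctan s ≤ s := fun s hs => by
    have := Real.le_tan (Real.arctan_nonneg.2 hs) (Real.arctan_lt_pi_div_two s)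
    rwa [Real.tan_arctan] at this
  rcases le_total 0 t with ht | ht
  · rw [abs_of_nonneg ht, abs_of_nonneg (Real.arctan_nonneg.2 ht)]
    exact key t ht
  · rw [abs_of_nonpos ht, abs_of_nonpos (Real.arctan_le_zero.2 ht), ← Real.arctan_neg]
    exact key _ (by linarith)

/-- The first-order expansion of the argument at infinity along the imaginary axis. -/
lemma tendsto_mul_arg_sub {a : ℝ → ℂ} {a₀ : ℂ} (ha : Tendsto a atTop (𝓝 a₀)) :
    Tendsto (fun y : ℝ => y * (arg (y * I - a y) - Real.pi / 2)) atTop (𝓝 a₀.re) := by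
  have h1 : Tendsto (fun y : ℝ => (y : ℂ) * (I * a y / y)) atTop (𝓝 (I * a₀)) := by
    refine (ha.const_mul I).congr' ?_
    filter_upwards [eventually_gt_atTop 0] with y hy
    have : (y : ℂ) ≠ 0 := ofReal_ne_zero.2 hy.ne'
    field_simp
  have h2 := (continuous_im.tendsto _).comp (Complex.tendsto_mul_log_one_add_of_tendsto h1)
  have h3 : (I * a₀).im = a₀.re := by simp
  rw [h3] at h2
  refine h2.congr' ?_
  have hb : ∀ᶠ y in atTop, (a y).im < a₀.im + 1 :=
    ((continuous_im.tendsto a₀).comp ha).eventually_lt_const (by linarith)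
  filter_upwards [eventually_gt_atTop 0, eventually_gt_atTop (a₀.im + 1), hb] with y hy hy1 hy2
  have him : 0 < (y * I - a y).im := by simp; linarith
  have hy' : (y : ℂ) ≠ 0 := ofReal_ne_zero.2 hy.ne'
  have h4 : -I * (y * I - a y) = y * (1 + I * a y / y) := by
    field_simp
    ring_nf
    simp
  rw [← arg_neg_I_mul him, h4, arg_real_mul _ hy]
  simp [log_im]

/-- The holomorphic logarithm of `√((z - p) (z - p̄))`, `p = f Y + i Y`, on the complement in the
upper half-plane of the part below height `Y` of the graph of `f` over the imaginary axis. -/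
noncomputable def slitLog (f : ℝ → ℝ) (Y : ℝ) (z : ℂ) : ℂ :=
  ((if z.re < f z.im then log (-(z - ⟨f Y, Y⟩)) + Real.pi * I else log (z - ⟨f Y, Y⟩)) +
    log (z - ⟨f Y, -Y⟩)) / 2

/-- The part of the graph of `f` over the imaginary axis between heights `0` and `Y`. -/
def graphSlit (f : ℝ → ℝ) (Y : ℝ) : Set ℂ := (fun y : ℝ => (⟨f y, y⟩ : ℂ)) '' Icc 0 Y

lemma slitLog_im (f : ℝ → ℝ) (Y : ℝ) (z : ℂ) :
    (slitLog f Y z).im = ((if z.re < f z.im then arg (-(z - ⟨f Y, Y⟩)) + Real.pi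
      else arg (z - ⟨f Y, Y⟩)) + arg (z - ⟨f Y, -Y⟩)) / 2 := by
  unfold slitLog
  split_ifs <;> simp [log_im]

lemma slitLog_of_lt_im {f : ℝ → ℝ} {Y : ℝ} {z : ℂ} (hz : Y < z.im) :
    slitLog f Y z = (log (z - ⟨f Y, Y⟩) + log (z - ⟨f Y, -Y⟩)) / 2 := by
  have : 0 < (z - ⟨f Y, Y⟩).im := by simpa using hz
  unfold slitLog
  rw [log_neg_add_pi_mul_I this, ite_self]

lemma abs_slitLog_im_le (f : ℝ → ℝ) (Y : ℝ) (z : ℂ) : |(slitLog f Y z).im| ≤ 2 * Real.pi := by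
  rw [slitLog_im]
  have h1 := abs_le.1 (abs_arg_le_pi (-(z - ⟨f Y, Y⟩)))
  have h2 := abs_le.1 (abs_arg_le_pi (z - ⟨f Y, Y⟩))
  have h3 := abs_le.1 (abs_arg_le_pi (z - ⟨f Y, -Y⟩))
  have hpi := Real.pi_pos
  split_ifs <;> exact abs_le.2 ⟨by linarith, by linarith⟩

lemma mem_graphSlit {f : ℝ → ℝ} {Y : ℝ} {z : ℂ} :
    z ∈ graphSlit f Y ↔ z.re = f z.im ∧ 0 ≤ z.im ∧ z.im ≤ Y := by
  constructor
  · rintro ⟨y, hy, rfl⟩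
    exact ⟨rfl, hy⟩
  · rintro ⟨h1, h2⟩
    exact ⟨z.im, h2, Complex.ext h1.symm rfl⟩

lemma isClosed_graphSlit {f : ℝ → ℝ} (hf : Continuous f) (Y : ℝ) : IsClosed (graphSlit f Y) := by
  have : graphSlit f Y = {z : ℂ | z.re = f z.im ∧ 0 ≤ z.im ∧ z.im ≤ Y} := by
    ext z; exact mem_graphSlit
  rw [this]
  exact (isClosed_eq continuous_re (hf.comp continuous_im)).inter
    ((isClosed_le continuous_const continuous_im).inter
      (isClosed_le continuous_im continuous_const))

lemma differentiableOn_slitLog {f : ℝ → ℝ} (hf : Continuous f) {Y : ℝ} (hY : 0 ≤ Y) :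
    DifferentiableOn ℂ (slitLog f Y) (UHP \ graphSlit f Y) := by
  intro z hz
  have hz0 : 0 < z.im := hz.1
  refine DifferentiableAt.differentiableWithinAt ?_
  have d2 : DifferentiableAt ℂ (fun z : ℂ => log (z - ⟨f Y, -Y⟩)) z :=
    (differentiableAt_id.sub_const _).clog (Or.inr (by simp; linarith))
  by_cases hup : Y < z.im
  · have d1 : DifferentiableAt ℂ (fun z : ℂ => log (z - ⟨f Y, Y⟩)) z :=
      (differentiableAt_id.sub_const _).clog (Or.inr (by simp; linarith))
    refine ((d1.add d2).div_const 2).congr_of_eventuallyEq ?_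
    filter_upwards [(isOpen_lt continuous_const continuous_im).mem_nhds hup] with w hw
    exact slitLog_of_lt_im hw
  have hne : z.re ≠ f z.im := fun h => hz.2 (mem_graphSlit.2 ⟨h, hz0.le, not_lt.1 hup⟩)
  have hfi : Continuous fun z : ℂ => f z.im := hf.comp continuous_im
  rcases lt_or_gt_of_ne hne with hlt | hgt
  · have d1 : DifferentiableAt ℂ (fun z : ℂ => log (-(z - ⟨f Y, Y⟩)) + Real.pi * I) z := by
      refine (DifferentiableAt.clog (differentiableAt_id.sub_const _).neg ?_).add_const _
      by_cases h : z.im = Y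
      · rw [h] at hlt
        exact Or.inl (by simpa using hlt)
      · exact Or.inr (by simpa [sub_eq_zero, eq_comm] using h)
    refine ((d1.add d2).div_const 2).congr_of_eventuallyEq ?_
    filter_upwards [(isOpen_lt continuous_re hfi).mem_nhds hlt] with w hw
    have hw' : w.re < f w.im := hw
    simp [slitLog, hw']
  · have d1 : DifferentiableAt ℂ (fun z : ℂ => log (z - ⟨f Y, Y⟩)) z := by
      refine (differentiableAt_id.sub_const _).clog ?_
      by_cases h : z.im = Y
      · rw [h] at hgt
        exact Or.inl (by simpa using hgt)
      · exact Or.inr (by simpa [sub_eq_zero] using h)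
    refine ((d1.add d2).div_const 2).congr_of_eventuallyEq ?_
    filter_upwards [(isOpen_lt hfi continuous_re).mem_nhds hgt] with w hw
    have hw' : ¬ w.re < f w.im := not_lt.2 (le_of_lt hw)
    simp [slitLog, hw']

/-- The harmonic function `re (slitMajorant a Y z)` is `a (y + Y) / (x² + (y + Y)²)`. -/
noncomputable def slitMajorant (a Y : ℝ) (z : ℂ) : ℂ := a * (I / (z + Y * I))

lemma slitMajorant_re (a Y : ℝ) (z : ℂ) :
    (slitMajorant a Y z).re = a * ((z.im + Y) / (z.re ^ 2 + (z.im + Y) ^ 2)) := by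
  simp [slitMajorant, div_re, normSq_apply, sq]

/-- Below height `Y`, the imaginary part of `slitLog`, up to a multiple of `π`. -/
noncomputable def slitArg (f : ℝ → ℝ) (Y : ℝ) (z : ℂ) : ℝ :=
  (arg (I * (z - ⟨f Y, Y⟩)) + arg (-I * (z - ⟨f Y, -Y⟩))) / 2

lemma slitLog_im_of_im_lt {f : ℝ → ℝ} {Y : ℝ} {z : ℂ} (hz : z.im < Y) (hz0 : 0 < z.im + Y) :
    (slitLog f Y z).im = if z.re < f z.im then slitArg f Y z + Real.pi else slitArg f Y z := by
  have h1 : (z - ⟨f Y, Y⟩).im < 0 := by simpa using hz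
  have h2 : 0 < (z - ⟨f Y, -Y⟩).im := by simpa using hz0
  rw [slitLog_im, slitArg, arg_I_mul h1, arg_neg_I_mul h2, arg_neg_eq_arg_add_pi_of_im_neg h1]
  split_ifs <;> ring

lemma slitArg_re_pos {f : ℝ → ℝ} {Y : ℝ} {z : ℂ} (hz : z.im < Y) (hz0 : 0 < z.im + Y) :
    0 < (I * (z - ⟨f Y, Y⟩)).re ∧ 0 < (-I * (z - ⟨f Y, -Y⟩)).re := by
  constructor
  · simpa using hz
  · simpa using hz0

lemma abs_slitArg_lt {f : ℝ → ℝ} {Y : ℝ} {z : ℂ} (hz : z.im < Y) (hz0 : 0 < z.im + Y) :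
    |slitArg f Y z| < Real.pi / 2 := by
  obtain ⟨p1, p2⟩ := slitArg_re_pos (f := f) hz hz0
  have h1 := abs_lt.1 (abs_arg_lt_pi_div_two_iff.2 (Or.inl p1))
  have h2 := abs_lt.1 (abs_arg_lt_pi_div_two_iff.2 (Or.inl p2))
  rw [slitArg, abs_lt]
  constructor <;> linarith

lemma slitArg_eq {f : ℝ → ℝ} {Y : ℝ} {z : ℂ} (hz : z.im < Y) (hz0 : 0 < z.im + Y) :
    slitArg f Y z = (Real.arctan ((z.re - f Y) / (Y - z.im)) -
      Real.arctan ((z.re - f Y) / (Y + z.im))) / 2 := by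
  obtain ⟨p1, p2⟩ := slitArg_re_pos (f := f) hz hz0
  rw [slitArg, arg_eq_arctan_of_re_pos p1, arg_eq_arctan_of_re_pos p2,
    sub_eq_add_neg (Real.arctan _), ← Real.arctan_neg, ← neg_div]
  simp [add_comm]

lemma continuousAt_slitArg {f : ℝ → ℝ} {Y : ℝ} {z : ℂ} (hz : z.im < Y) (hz0 : 0 < z.im + Y) :
    ContinuousAt (slitArg f Y) z := by
  obtain ⟨p1, p2⟩ := slitArg_re_pos (f := f) hz hz0
  have c1 : ContinuousAt (fun z : ℂ => I * (z - ⟨f Y, Y⟩)) z := by fun_prop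
  have c2 : ContinuousAt (fun z : ℂ => -I * (z - ⟨f Y, -Y⟩)) z := by fun_prop
  exact (((continuousAt_arg (Or.inl p1)).comp_of_eq c1 rfl).add
    ((continuousAt_arg (Or.inl p2)).comp_of_eq c2 rfl)).div_const 2

lemma abs_slitArg_le {f : ℝ → ℝ} {m Y : ℝ} (hm : 0 ≤ m) (hm1 : m ≤ 1)
    (hf : ∀ a b, |f a - f b| ≤ m * |a - b|) (hf0 : f 0 = 0) {z : ℂ} (hz : z.im < Y)
    (hz0 : 0 ≤ z.im) (hmem : z.im = 0 ∨ z.re = f z.im) :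
    |slitArg f Y z| ≤ (slitMajorant (3 * Y * m) Y z).re := by
  have hY : 0 < Y := hz0.trans_lt hz
  rw [slitArg_eq hz (by linarith), slitMajorant_re]
  by_cases h0 : z.im = 0
  · rw [h0, sub_zero, add_zero, sub_self, zero_div, abs_zero]
    positivity
  have hre := hmem.resolve_left h0
  have hd : |z.re - f Y| ≤ m * (Y - z.im) := by
    have := hf z.im Y
    rwa [← hre, abs_sub_comm z.im Y, abs_of_pos (show 0 < Y - z.im by linarith)] at this
  have h1 : |Real.arctan ((z.re - f Y) / (Y - z.im))| ≤ m := by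
    refine (abs_arctan_le _).trans ?_
    rw [abs_div, abs_of_pos (show 0 < Y - z.im by linarith), div_le_iff₀ (by linarith)]
    exact hd
  have h2 : |Real.arctan ((z.re - f Y) / (Y + z.im))| ≤ m := by
    refine (abs_arctan_le _).trans ?_
    rw [abs_div, abs_of_pos (show 0 < Y + z.im by linarith), div_le_iff₀ (by linarith)]
    exact hd.trans (mul_le_mul_of_nonneg_left (by linarith) hm)
  have hx : |z.re| ≤ z.im := by
    have := hf z.im 0
    rw [← hre, hf0, sub_zero, sub_zero, abs_of_nonneg hz0] at this
    nlinarith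
  have hx2 : z.re ^ 2 ≤ z.im ^ 2 := sq_le_sq' (by linarith [(abs_le.1 hx).1]) (abs_le.1 hx).2
  have hmaj : m ≤ 3 * Y * m * ((z.im + Y) / (z.re ^ 2 + (z.im + Y) ^ 2)) := by
    rw [← mul_div_assoc, le_div_iff₀ (by positivity)]
    have : z.re ^ 2 + (z.im + Y) ^ 2 ≤ 3 * Y * (z.im + Y) := by nlinarith
    nlinarith
  refine le_trans ?_ hmaj
  have h3 := abs_le.1 h1
  have h4 := abs_le.1 h2
  exact abs_le.2 ⟨by linarith, by linarith⟩

lemma slitLog_boundary {f : ℝ → ℝ} {m Y : ℝ} (hm : 0 ≤ m) (hm1 : m ≤ 1)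
    (hf : ∀ a b, |f a - f b| ≤ m * |a - b|) (hf0 : f 0 = 0) (hY : 0 ≤ Y) {z₀ : ℂ}
    (hz₀ : z₀ ∉ UHP \ graphSlit f Y) (him : 0 ≤ z₀.im) (hp : z₀ ≠ ⟨f Y, Y⟩) {δ : ℝ} (hδ : 0 < δ) :
    ∀ᶠ z in 𝓝[UHP \ graphSlit f Y] z₀,
      (|(slitLog f Y z).im - 0| < Real.pi / 2 ∧
        |(slitLog f Y z).im| ≤ (slitMajorant (3 * Y * m) Y z).re + δ) ∨
      (|(slitLog f Y z).im - Real.pi| < Real.pi / 2 ∧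
        |(slitLog f Y z).im - Real.pi| ≤ (slitMajorant (3 * Y * m) Y z).re + δ) := by
  have hpi := Real.pi_pos
  have hcase : z₀.im = 0 ∨ (z₀.re = f z₀.im ∧ z₀.im ≤ Y) := by
    rcases him.eq_or_lt with h | h
    · exact Or.inl h.symm
    · right
      have : z₀ ∈ graphSlit f Y := by
        by_contra h'
        exact hz₀ ⟨h, h'⟩
      exact ⟨(mem_graphSlit.1 this).1, (mem_graphSlit.1 this).2.2⟩
  rcases hY.eq_or_lt with rfl | hYpos
  · have h0 : z₀.im = 0 := hcase.elim id fun h => le_antisymm h.2 him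
    have hre : z₀.re ≠ 0 := fun h => hp (Complex.ext (by simp [hf0, h]) h0)
    have hv : ∀ z ∈ UHP \ graphSlit f 0, (slitLog f 0 z).im = arg z := by
      intro z hz
      rw [slitLog_of_lt_im hz.1, neg_zero, hf0]
      have : (⟨0, 0⟩ : ℂ) = 0 := rfl
      simp [this, log_im]
    have hQ : ∀ z, (slitMajorant (3 * 0 * m) 0 z).re = 0 := by intro z; simp [slitMajorant_re]
    have hμ : 0 < min δ (Real.pi / 2) := lt_min hδ (by linarith)
    have hsub : UHP \ graphSlit f 0 ⊆ {z : ℂ | 0 ≤ z.im} := fun z hz => show 0 ≤ z.im from le_of_lt hz.1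
    rcases lt_or_gt_of_ne hre with hlt | hgt
    · have hc := (continuousWithinAt_arg_of_re_neg_of_im_zero hlt h0).mono hsub
      have ha : arg z₀ = Real.pi := arg_eq_pi_iff.2 ⟨hlt, h0⟩
      filter_upwards [hc.tendsto (Metric.ball_mem_nhds _ hμ), self_mem_nhdsWithin] with z hz hzΩ
      have hz' : |arg z - arg z₀| < min δ (Real.pi / 2) := hz
      rw [ha] at hz'
      right
      rw [hv z hzΩ, hQ, zero_add]
      exact ⟨hz'.trans_le (min_le_right _ _), (hz'.trans_le (min_le_left _ _)).le⟩
    · have hc := (continuousAt_arg (x := z₀) (Or.inl hgt)).continuousWithinAt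
        (s := UHP \ graphSlit f 0)
      have ha : arg z₀ = 0 := arg_eq_zero_iff.2 ⟨le_of_lt hgt, h0⟩
      filter_upwards [hc.tendsto (Metric.ball_mem_nhds _ hμ), self_mem_nhdsWithin] with z hz hzΩ
      have hz' : |arg z - arg z₀| < min δ (Real.pi / 2) := hz
      rw [ha, sub_zero] at hz'
      left
      rw [hv z hzΩ, hQ, zero_add, sub_zero]
      exact ⟨hz'.trans_le (min_le_right _ _), (hz'.trans_le (min_le_left _ _)).le⟩
  have hlt : z₀.im < Y := by
    rcases hcase with h | ⟨h1, h2⟩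
    · linarith
    · refine lt_of_le_of_ne h2 fun h => hp (Complex.ext ?_ h)
      rw [h1, h]
  have hbd := abs_slitArg_le hm hm1 hf hf0 hlt him (hcase.imp id And.left)
  have hQc : ContinuousAt (fun z => (slitMajorant (3 * Y * m) Y z).re) z₀ := by
    simp only [slitMajorant_re]
    have hne : z₀.re ^ 2 + (z₀.im + Y) ^ 2 ≠ 0 := by positivity
    fun_prop (disch := exact hne)
  have hAc := (continuousAt_slitArg (f := f) hlt (by linarith)).abs
  have hcmp : ∀ᶠ z in 𝓝 z₀, |slitArg f Y z| < (slitMajorant (3 * Y * m) Y z).re + δ :=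
    hAc.tendsto.eventually_lt (hQc.tendsto.add_const δ) (by linarith)
  filter_upwards [nhdsWithin_le_nhds hcmp, self_mem_nhdsWithin,
    nhdsWithin_le_nhds ((isOpen_lt continuous_im continuous_const).mem_nhds hlt)] with z h1 hz h2
  have h2' : z.im < Y := h2
  have hz0 : 0 < z.im := hz.1
  have h3 := abs_slitArg_lt (f := f) h2' (by linarith)
  rw [slitLog_im_of_im_lt h2' (by linarith)]
  split_ifs
  · right
    rw [add_sub_cancel_right]
    exact ⟨h3, h1.le⟩
  · left
    rw [sub_zero]
    exact ⟨h3, h1.le⟩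

lemma differentiableOn_slitMajorant (a : ℝ) {Y : ℝ} (hY : 0 ≤ Y) :
    DifferentiableOn ℂ (slitMajorant a Y) UHP := by
  intro z hz
  have hz0 : 0 < z.im := hz
  have hne : z + Y * I ≠ 0 := fun h => by
    have := congrArg im h
    simp at this
    linarith
  unfold slitMajorant
  exact DifferentiableAt.differentiableWithinAt (by fun_prop (disch := exact hne))

lemma eventually_bounds_near_real {f : ℝ → ℝ} {m : ℝ} (hm1 : m ≤ 1)
    (hf : ∀ a b, |f a - f b| ≤ m * |a - b|) (hf0 : f 0 = 0) (x : ℝ) :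
    ∀ᶠ z : ℂ in 𝓝 (x : ℂ), |f z.im| < 1 ∧ |z.re - x| < 1 := by
  have h1 : ∀ᶠ z : ℂ in 𝓝 (x : ℂ), |z.im| < 1 :=
    (isOpen_lt continuous_im.abs continuous_const).mem_nhds (by simp)
  have h2 : ∀ᶠ z : ℂ in 𝓝 (x : ℂ), |z.re - x| < 1 :=
    (isOpen_lt (continuous_re.sub continuous_const).abs continuous_const).mem_nhds (by simp)
  filter_upwards [h1, h2] with z h1 h2
  refine ⟨?_, h2⟩
  have := hf z.im 0
  rw [hf0, sub_zero, sub_zero] at this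
  nlinarith [abs_nonneg z.im]

lemma neBot_nhdsWithin_compl_graphSlit {f : ℝ → ℝ} (hf : Continuous f) (hf0 : f 0 = 0) (Y : ℝ)
    {x : ℝ} (hx : x ≠ 0) : (𝓝[UHP \ graphSlit f Y] (x : ℂ)).NeBot := by
  have hmem : (graphSlit f Y)ᶜ ∈ 𝓝 (x : ℂ) :=
    (isClosed_graphSlit hf Y).isOpen_compl.mem_nhds fun h => hx (by
      simpa [hf0] using (mem_graphSlit.1 h).1)
  rw [sdiff_eq, nhdsWithin_inter_of_mem' (nhdsWithin_le_nhds hmem)]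
  exact neBot_nhdsWithin_UHP (by simp)

/-- Loewner driving value of a slit that is a Lipschitz graph over the imaginary axis. -/
lemma abs_driving_le_of_graphSlit {f : ℝ → ℝ} {m Y W : ℝ} (hm : 0 ≤ m) (hm1 : m ≤ 1) (hY : 0 ≤ Y)
    (hf : ∀ a b, |f a - f b| ≤ m * |a - b|) (hf0 : f 0 = 0) {g : ℂ → ℂ}
    (hg : IsMappingOut (graphSlit f Y) g)
    (hW : Tendsto g (𝓝[UHP \ graphSlit f Y] ⟨f Y, Y⟩) (𝓝 (W : ℂ))) : |W| ≤ 4 * m * Y := by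
  obtain ⟨hgd, hgb, hginf⟩ := hg
  rw [comap_norm_atTop] at hginf
  have hpi := Real.pi_pos
  have hfc : Continuous f :=
    (LipschitzWith.of_dist_le_mul (K := ⟨m, hm⟩) fun a b => hf a b).continuous
  have hfY : |f Y| ≤ m * Y := by
    have := hf Y 0
    rwa [hf0, sub_zero, sub_zero, abs_of_nonneg hY] at this
  have hfY1 : |f Y| ≤ Y := hfY.trans (by nlinarith)
  have hfY2 := abs_le.1 hfY1
  have ho : IsOpen (UHP \ graphSlit f Y) := isOpen_UHP.sdiff (isClosed_graphSlit hfc Y)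
  have key := fun z hz => abs_arg_sub_im_le ho sdiff_subset hgd hgb hginf hW
    (differentiableOn_slitLog hfc hY)
    ((differentiableOn_slitMajorant (3 * Y * m) hY).mono sdiff_subset)
    (fun z hz => by
      have hz0 : 0 < z.im := hz.1
      rw [slitMajorant_re]
      positivity)
    (fun z _ => abs_slitLog_im_le f Y z)
    (fun z₀ h1 h2 h3 δ hδ => slitLog_boundary hm hm1 hf hf0 hY h1 h2 h3 hδ)
    (by
      refine Eventually.frequently ?_
      filter_upwards [eventually_gt_atTop (Y + 2)] with x hx
      refine ⟨neBot_nhdsWithin_compl_graphSlit hfc hf0 Y (by linarith), ?_⟩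
      filter_upwards [nhdsWithin_le_nhds (eventually_bounds_near_real hm1 hf hf0 x)]
        with z ⟨h1, h2⟩
      have h1 := abs_lt.1 h1
      have h2 := abs_lt.1 h2
      have a1 := abs_lt.1 (abs_arg_lt_pi_div_two_iff.2
        (Or.inl (show 0 < (z - ⟨f Y, Y⟩).re by simp; linarith)))
      have a2 := abs_lt.1 (abs_arg_lt_pi_div_two_iff.2
        (Or.inl (show 0 < (z - ⟨f Y, -Y⟩).re by simp; linarith)))
      rw [slitLog_im, if_neg (by linarith), sub_zero, abs_lt]
      constructor <;> linarith)
    (by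
      refine Eventually.frequently ?_
      filter_upwards [eventually_lt_atBot (-(Y + 2))] with x hx
      refine ⟨neBot_nhdsWithin_compl_graphSlit hfc hf0 Y (by linarith), ?_⟩
      filter_upwards [nhdsWithin_le_nhds (eventually_bounds_near_real hm1 hf hf0 x),
        self_mem_nhdsWithin] with z ⟨h1, h2⟩ hz
      have hz0 : 0 < z.im := hz.1
      have h1 := abs_lt.1 h1
      have h2 := abs_lt.1 h2
      have a1 := abs_lt.1 (abs_arg_lt_pi_div_two_iff.2
        (Or.inl (show 0 < (-(z - ⟨f Y, Y⟩)).re by simp; linarith)))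
      have a2 : Real.pi / 2 < arg (z - ⟨f Y, -Y⟩) := by
        by_contra! h
        rcases arg_le_pi_div_two_iff.1 h with h | h
        · simp at h; linarith
        · simp at h; linarith
      have a3 := arg_le_pi (z - ⟨f Y, -Y⟩)
      rw [slitLog_im, if_pos (by linarith), abs_lt]
      constructor <;> linarith) (z := z) hz
  have hmem : ∀ᶠ y : ℝ in atTop, (y * I : ℂ) ∈ UHP \ graphSlit f Y := by
    filter_upwards [eventually_gt_atTop Y] with y hy
    refine ⟨show 0 < (y * I : ℂ).im by simp; linarith, fun h => ?_⟩
    have := (mem_graphSlit.1 h).2.2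
    simp at this
    linarith
  have htop : Tendsto (fun y : ℝ => (y * I : ℂ)) atTop
      (cobounded ℂ ⊓ 𝓟 (UHP \ graphSlit f Y)) := by
    refine tendsto_inf.2 ⟨?_, tendsto_principal.2 hmem⟩
    rw [← tendsto_norm_atTop_iff_cobounded]
    simpa using tendsto_abs_atTop_atTop
  have hu := tendsto_mul_arg_sub ((hginf.comp htop).const_sub (W : ℂ))
  have hv1 := tendsto_mul_arg_sub (tendsto_const_nhds (x := (⟨f Y, Y⟩ : ℂ)))
  have hv2 := tendsto_mul_arg_sub (tendsto_const_nhds (x := (⟨f Y, -Y⟩ : ℂ)))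
  have hlim := (hu.sub ((hv1.add hv2).div_const 2)).abs
  have hle := le_of_tendsto (b := 3 * Y * m) hlim (by
    filter_upwards [eventually_gt_atTop Y, hmem] with y hy hyΩ
    have hy0 : 0 < y := by linarith
    have h := key _ hyΩ
    rw [slitLog_of_lt_im (by simpa using hy), slitMajorant_re] at h
    have e : g (y * I) - W = y * I - (W - (g (y * I) - y * I)) := by ring
    rw [e] at h
    have e2 : y * (arg (y * I - (W - (g (y * I) - y * I))) - Real.pi / 2) -
        (y * (arg (y * I - ⟨f Y, Y⟩) - Real.pi / 2) +
          y * (arg (y * I - ⟨f Y, -Y⟩) - Real.pi / 2)) / 2 =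
        y * (arg (y * I - (W - (g (y * I) - y * I))) -
          ((log (y * I - ⟨f Y, Y⟩) + log (y * I - ⟨f Y, -Y⟩)) / 2).im) := by
      simp [log_im]
      ring
    show |y * (arg (y * I - (W - (g (y * I) - y * I))) - Real.pi / 2) -
        (y * (arg (y * I - ⟨f Y, Y⟩) - Real.pi / 2) +
          y * (arg (y * I - ⟨f Y, -Y⟩) - Real.pi / 2)) / 2| ≤ _
    rw [e2, abs_mul, abs_of_pos hy0]
    refine (mul_le_mul_of_nonneg_left h hy0.le).trans ?_
    have e3 : y * (3 * Y * m * (((y * I : ℂ).im + Y) / ((y * I : ℂ).re ^ 2 +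
        ((y * I : ℂ).im + Y) ^ 2))) = 3 * Y * m * (y / (y + Y)) := by
      have : y + Y ≠ 0 := by positivity
      simp
      field_simp
    rw [e3]
    exact mul_le_of_le_one_right (by positivity) ((div_le_one (by positivity)).2 (by linarith)))
  have h1 := abs_le.1 (show |W - f Y| ≤ 3 * Y * m by simpa using hle)
  have h2 := abs_le.1 hfY
  exact abs_le.2 ⟨by linarith, by linarith⟩

lemma abs_re_le_tan_mul_im {d : ℂ} {θ : ℝ} (hθ : θ < Real.pi / 4)
    (hd : |Real.pi / 2 - arg d| ≤ θ) : 0 ≤ d.im ∧ |d.re| ≤ Real.tan θ * d.im := by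
  have hpi := Real.pi_pos
  have hθ0 : 0 ≤ θ := (abs_nonneg _).trans hd
  have hcos : 0 < Real.cos θ := Real.cos_pos_of_mem_Ioo ⟨by linarith, by linarith⟩
  have h1 : Real.cos θ ≤ Real.sin (arg d) := by
    rw [← Real.cos_pi_div_two_sub, ← Real.cos_abs (Real.pi / 2 - arg d)]
    exact Real.cos_le_cos_of_nonneg_of_le_pi (abs_nonneg _) (by linarith) hd
  have h2 : |Real.cos (arg d)| ≤ Real.sin θ := by
    rw [← Real.sin_pi_div_two_sub]
    obtain ⟨l, u⟩ := abs_le.1 hd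
    rw [abs_le, ← Real.sin_neg]
    exact ⟨Real.sin_le_sin_of_le_of_le_pi_div_two (by linarith) (by linarith) l,
      Real.sin_le_sin_of_le_of_le_pi_div_two (by linarith) (by linarith) u⟩
  rw [← norm_mul_sin_arg d, ← norm_mul_cos_arg d, abs_mul, abs_norm]
  refine ⟨mul_nonneg (norm_nonneg _) (hcos.le.trans h1), ?_⟩
  rw [mul_left_comm]
  refine mul_le_mul_of_nonneg_left (h2.trans ?_) (norm_nonneg _)
  rw [← Real.tan_mul_cos hcos.ne']
  exact mul_le_mul_of_nonneg_left h1
    (Real.tan_nonneg_of_nonneg_of_le_pi_div_two hθ0 (by linarith))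

/-- A curve whose tangent stays within angle `θ < π/4` of the vertical is a graph over the
imaginary axis. -/
lemma exists_graphSlit_of_abs_arg_deriv_le {η : ℝ → ℂ} {S θ s : ℝ}
    (hc : ContinuousOn η (Icc 0 S)) (h0 : η 0 = 0) (hθ0 : 0 ≤ θ) (hθ : θ < Real.pi / 4)
    (harg : ∀ u ∈ Ioo 0 S, |Real.pi / 2 - arg (derivWithin η (Icc 0 S) u)| ≤ θ)
    (hs : s ∈ Icc 0 S) :
    ∃ f : ℝ → ℝ, (∀ a b, |f a - f b| ≤ Real.tan θ * |a - b|) ∧ f 0 = 0 ∧ 0 ≤ (η s).im ∧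
      η s = ⟨f (η s).im, (η s).im⟩ ∧ η '' Icc 0 s = graphSlit f (η s).im := by
  have hpi := Real.pi_pos
  set m := Real.tan θ
  have hm : 0 ≤ m := Real.tan_nonneg_of_nonneg_of_le_pi_div_two hθ0 (by linarith)
  have hderiv : ∀ u ∈ Ioo 0 S, HasDerivAt η (derivWithin η (Icc 0 S) u) u := by
    intro u hu
    refine HasDerivWithinAt.hasDerivAt (DifferentiableWithinAt.hasDerivWithinAt ?_)
      (Icc_mem_nhds hu.1 hu.2)
    by_contra h
    have := harg u hu
    rw [derivWithin_zero_of_not_differentiableWithinAt h, arg_zero, sub_zero,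
      abs_of_pos (by linarith)] at this
    linarith
  have hmono : ∀ L : ℂ →L[ℝ] ℝ, (∀ d : ℂ, 0 ≤ d.im → |d.re| ≤ m * d.im → 0 ≤ L d) →
      MonotoneOn (fun u => L (η u)) (Icc 0 S) := by
    intro L hL
    have hd : ∀ u ∈ interior (Icc 0 S),
        HasDerivAt (fun u => L (η u)) (L (derivWithin η (Icc 0 S) u)) u := fun u hu =>
      L.hasFDerivAt.comp_hasDerivAt u (hderiv u (interior_Icc (a := (0 : ℝ)) ▸ hu))
    refine monotoneOn_of_deriv_nonneg (convex_Icc 0 S) (L.continuous.comp_continuousOn hc)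
      (fun u hu => (hd u hu).differentiableAt.differentiableWithinAt) fun u hu => ?_
    rw [(hd u hu).deriv]
    rw [interior_Icc] at hu
    exact (abs_re_le_tan_mul_im hθ (harg u hu)).elim (hL _)
  have him : MonotoneOn (fun u => (η u).im) (Icc 0 S) := hmono imCLM fun d hd _ => hd
  have hadd := hmono (m • imCLM + reCLM) fun d _ hd => by
    have := (abs_le.1 hd).1
    simp
    linarith
  have hsub := hmono (m • imCLM - reCLM) fun d _ hd => by
    have := (abs_le.1 hd).2
    simp
    linarith
  have hcone : ∀ a ∈ Icc 0 S, ∀ b ∈ Icc 0 S,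
      |(η a).re - (η b).re| ≤ m * |(η a).im - (η b).im| := by
    have main : ∀ a ∈ Icc 0 S, ∀ b ∈ Icc 0 S, a ≤ b →
        |(η b).re - (η a).re| ≤ m * |(η b).im - (η a).im| := by
      intro a ha b hb hab
      have h1 : (η a).im ≤ (η b).im := him ha hb hab
      have h2 : m * (η a).im + (η a).re ≤ m * (η b).im + (η b).re := hadd ha hb hab
      have h3 : m * (η a).im - (η a).re ≤ m * (η b).im - (η b).re := hsub ha hb hab
      rw [abs_of_nonneg (sub_nonneg.2 h1), mul_sub]
      exact abs_le.2 ⟨by linarith, by linarith⟩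
    intro a ha b hb
    rcases le_total a b with hab | hab
    · rw [abs_sub_comm (η a).re, abs_sub_comm (η a).im]
      exact main a ha b hb hab
    · exact main b hb a ha hab
  have hsS : Icc 0 s ⊆ Icc 0 S := Icc_subset_Icc_right hs.2
  have h0S : (0 : ℝ) ∈ Icc 0 S := ⟨le_rfl, hs.1.trans hs.2⟩
  set Y := (η s).im
  have hY : 0 ≤ Y := by simpa [h0] using him h0S hs hs.1
  have hivt : ∀ y ∈ Icc 0 Y, ∃ u ∈ Icc 0 s, (η u).im = y := by
    have := intermediate_value_Icc hs.1 (continuous_im.comp_continuousOn (hc.mono hsS))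
    intro y hy
    exact this (by simpa [h0] using hy)
  choose! τ hτ hτy using hivt
  have hlip : LipschitzOnWith ⟨m, hm⟩ (fun y => (η (τ y)).re) (Icc 0 Y) :=
    LipschitzOnWith.of_dist_le_mul fun a ha b hb => by
      have := hcone _ (hsS (hτ a ha)) _ (hsS (hτ b hb))
      rwa [hτy a ha, hτy b hb] at this
  obtain ⟨f, hf, hfeq⟩ := hlip.extend_real
  have hgraph : ∀ u ∈ Icc 0 s, (η u).im ∈ Icc 0 Y ∧ η u = ⟨f (η u).im, (η u).im⟩ := by
    intro u hu
    have hu0 : (0 : ℝ) ≤ (η u).im := by simpa [h0] using him h0S (hsS hu) hu.1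
    have huY : (η u).im ∈ Icc 0 Y := ⟨hu0, him (hsS hu) hs hu.2⟩
    refine ⟨huY, Complex.ext ?_ rfl⟩
    have := hcone _ (hsS (hτ _ huY)) u (hsS hu)
    rw [hτy _ huY, sub_self, abs_zero, mul_zero, abs_nonpos_iff, sub_eq_zero] at this
    exact this.symm.trans (hfeq huY)
  refine ⟨f, fun a b => hf.dist_le_mul a b, ?_, hY, (hgraph s ⟨hs.1, le_rfl⟩).2, ?_⟩
  · have := congrArg re (hgraph 0 ⟨le_rfl, hs.1⟩).2
    simpa [h0] using this.symm
  · ext z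
    constructor
    · rintro ⟨u, hu, rfl⟩
      exact ⟨_, (hgraph u hu).1, (hgraph u hu).2.symm⟩
    · rintro ⟨y, hy, rfl⟩
      refine ⟨τ y, hτ y hy, ?_⟩
      rw [(hgraph _ (hτ y hy)).2, hτy y hy]

lemma norm_sqrtH (z : ℂ) : ‖sqrtH z‖ = √‖z‖ := by
  have h : sqrtH z ^ 2 = z := by
    have : ((-z) ^ ((1 : ℂ) / 2)) ^ 2 = -z := by
      rw [one_div]
      exact cpow_nat_inv_pow (-z) two_ne_zero
    rw [sqrtH, mul_pow, I_sq, this]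
    ring
  conv_rhs => rw [← h, norm_pow, Real.sqrt_sq (norm_nonneg _)]

lemma continuousAt_sqrtH {z : ℂ} (hz : ¬ (0 ≤ z.re ∧ z.im = 0)) : ContinuousAt sqrtH z := by
  have hslit : -z ∈ slitPlane := by
    rw [mem_slitPlane_iff]
    by_contra! h
    exact hz ⟨by simpa using h.1, by simpa using h.2⟩
  exact continuousAt_const.mul (continuousAt_id.neg.cpow continuousAt_const hslit)

lemma continuousAt_sqrtH_zero : ContinuousAt sqrtH 0 := by
  have h0 : sqrtH 0 = 0 := by rw [← norm_eq_zero, norm_sqrtH]; simp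
  rw [ContinuousAt, h0, tendsto_zero_iff_norm_tendsto_zero]
  simp only [norm_sqrtH]
  simpa using (continuous_norm.sqrt.tendsto (0 : ℂ))

lemma tan_le_two_mul {θ : ℝ} (hθ0 : 0 ≤ θ) (hθ : θ < Real.pi / 4) : Real.tan θ ≤ 2 * θ := by
  have hpi := Real.pi_pos
  have hcos : 1 / 2 ≤ Real.cos θ := by
    rw [← Real.cos_pi_div_three]
    exact Real.cos_le_cos_of_nonneg_of_le_pi hθ0 (by linarith) (by linarith)
  rw [Real.tan_eq_sin_div_cos, div_le_iff₀ (by linarith)]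
  nlinarith [Real.sin_le hθ0]

/-- There is a universal constant `c > 0` such that for any
`R`-regular arclength-parametrized `C^1` simple curve `γ` tangentially attached
to `ℝ₊` with `ω(R) ≤ 1/5`, if the tangent of `η = √γ` stays within angle `θ < π/4`
of the vertical, then the driving function satisfies `|W_{t(s)}| ≤ c·θ·√s`. -/
theorem nearly_vertical_driving_bound :
    ∃ c : ℝ, 0 < c ∧
      ∀ (S R θ : ℝ) (γ γ' : ℝ → ℂ) (ω t W : ℝ → ℝ),
        0 < S → 0 < R → R ≤ S →
        (∀ a b : ℝ, 0 ≤ a → a ≤ b → ω a ≤ ω b) →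
        (∀ s ∈ Set.Icc (0:ℝ) S, HasDerivWithinAt γ (γ' s) (Set.Icc 0 S) s) →
        (∀ s ∈ Set.Icc (0:ℝ) S, ‖γ' s‖ = 1) →
        (∀ s ∈ Set.Icc (0:ℝ) S, ∀ s' ∈ Set.Icc (0:ℝ) S,
          ‖γ' s - γ' s'‖ ≤ ω |s - s'|) →
        γ 0 = 0 → γ' 0 = -1 →
        Set.InjOn γ (Set.Icc 0 S) →
        (∀ s ∈ Set.Ioc (0:ℝ) S, ¬ (0 ≤ (γ s).re ∧ (γ s).im = 0)) →
        (∀ s ∈ Set.Icc (0:ℝ) S, ∀ r : ℝ, 0 < r → r ≤ R →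
          IsConnected (Metric.closedBall (γ s) r ∩
            ((fun u : ℝ => if 0 ≤ u then γ u else ((-u : ℝ) : ℂ)) '' Set.Iic S))) →
        ω R ≤ 1/5 →
        -- `t` is the half-plane capacity parametrization of `η = √γ`
        (∀ s ∈ Set.Icc (0:ℝ) S,
          HasHCap ((fun u => sqrtH (γ u)) '' Set.Icc 0 s) (2 * t s)) →
        -- `W` is the Loewner driving function of `η`
        (∀ s ∈ Set.Icc (0:ℝ) S, ∃ g : ℂ → ℂ,
          IsMappingOut ((fun u => sqrtH (γ u)) '' Set.Icc 0 s) g ∧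
          Tendsto g (nhdsWithin (sqrtH (γ s))
            (UHP \ ((fun u => sqrtH (γ u)) '' Set.Icc 0 s)))
            (nhds ((W (t s) : ℝ) : ℂ))) →
        -- the tangent of `η` stays within angle `θ` of the vertical
        0 ≤ θ → θ < Real.pi / 4 →
        (∀ s ∈ Set.Ioc (0:ℝ) S,
          |Real.pi / 2 -
            Complex.arg (derivWithin (fun u => sqrtH (γ u)) (Set.Icc 0 S) s)| ≤ θ) →
        ∀ s ∈ Set.Icc (0:ℝ) R, |W (t s)| ≤ c * θ * Real.sqrt s := by
  refine ⟨8, by norm_num, ?_⟩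
  intro S R θ γ γ' ω t W _ _ hRS _ hγ hγ' _ h0 _ _ hslit _ _ _ hW hθ0 hθ harg s hs
  have hsS : s ∈ Icc 0 S := ⟨hs.1, hs.2.trans hRS⟩
  have hnorm : ‖γ s‖ ≤ s := by
    have := (convex_Icc (0 : ℝ) S).norm_image_sub_le_of_norm_hasDerivWithin_le hγ
      (fun u hu => (hγ' u hu).le) (left_mem_Icc.2 (hsS.1.trans hsS.2)) hsS
    simpa [h0, abs_of_nonneg hs.1] using this
  have hc : ContinuousOn (fun u => sqrtH (γ u)) (Icc 0 S) := by
    intro u hu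
    refine ContinuousAt.comp_continuousWithinAt (g := sqrtH) ?_ (hγ u hu).continuousWithinAt
    rcases hu.1.eq_or_lt with rfl | hu0
    · rw [h0]
      exact continuousAt_sqrtH_zero
    · exact continuousAt_sqrtH (hslit u ⟨hu0, hu.2⟩)
  have hη0 : sqrtH (γ 0) = 0 := by rw [← norm_eq_zero, norm_sqrtH, h0]; simp
  obtain ⟨f, hf, hf0, hY, hp, hK⟩ := exists_graphSlit_of_abs_arg_deriv_le hc hη0 hθ0 hθ
    (fun u hu => harg u ⟨hu.1, hu.2.le⟩) hsS
  obtain ⟨g, hg, hgW⟩ := hW s hsS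
  have htan0 : 0 ≤ Real.tan θ :=
    Real.tan_nonneg_of_nonneg_of_le_pi_div_two hθ0 (by linarith [Real.pi_pos])
  have htan1 : Real.tan θ ≤ 1 := by
    rw [← Real.tan_pi_div_four]
    exact (Real.tan_lt_tan_of_nonneg_of_lt_pi_div_two hθ0 (by linarith [Real.pi_pos]) hθ).le
  have hYs : (sqrtH (γ s)).im ≤ √s :=
    (im_le_norm _).trans ((norm_sqrtH _).trans_le (Real.sqrt_le_sqrt hnorm))
  rw [hK] at hg hgW
  have hbound := abs_driving_le_of_graphSlit htan0 htan1 hY hf hf0 hg (hp ▸ hgW)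
  calc |W (t s)| ≤ 4 * Real.tan θ * (sqrtH (γ s)).im := hbound
    _ ≤ 4 * (2 * θ) * √s := by
      have := tan_le_two_mul hθ0 hθ
      gcongr
    _ = 8 * θ * √s := by ring
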